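/- arXiv:1711.05437 — 2 statements merged into one kernel-verified Lean document; each statement's English description precedes it below -/
import Mathlib

section
/- Assume G ≅ C_{n1} ⊕ … ⊕ C_{nr} with 1 < n1 | … | nr and D(G) ≥ 4. For every d ∈ Δ1(G) one has ρ*(G, d) ≥ K(G, d). In particular, if d ∈ [1, r−1], then ρ*(G, d) ≥ K(G, d) ≥ 1 + (n1 − 1)d/n1 ≥ 1 + d/2. -/
/- Common definitions: zero-sum sequences over a finite abelian group,
   sets of lengths, the system of sets of lengths, the Davenport constant,
   sets of distances, elasticities, AAPs, Δ₁(G), ρ(G,d,k), ρ(G,d), ρ*(G,d),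
   cross numbers, K(G₀), K(G,d), LCN-sets, Δ*(G). -/

open scoped Classical

section Defs

variable {G : Type*} [AddCommGroup G]

/-- The support of a sequence (multiset) over `G`. -/
def suppSet (A : Multiset G) : Set G := {g | g ∈ A}

/-- `A` is a minimal zero-sum sequence (an atom of `𝓑(G₀)`) over `G₀ ⊆ G`:
a nontrivial zero-sum sequence with terms in `G₀` such that every proper
nontrivial subsequence has nonzero sum. -/
def IsMinZeroSum (G0 : Set G) (A : Multiset G) : Prop :=
  A ≠ 0 ∧ (∀ g ∈ A, g ∈ G0) ∧ A.sum = 0 ∧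
    ∀ T : Multiset G, T ≤ A → T.sum = 0 → T = 0 ∨ T = A

/-- `B` is a zero-sum sequence over `G₀ ⊆ G` (an element of `𝓑(G₀)`). -/
def IsZeroSumSeq (G0 : Set G) (B : Multiset G) : Prop :=
  (∀ g ∈ B, g ∈ G0) ∧ B.sum = 0

/-- The set of lengths `L(B)` of a zero-sum sequence `B` over `G₀`:
all `k` such that `B` is a product of `k` atoms of `𝓑(G₀)`.
(For the trivial sequence this is `{0}`.) -/
def lengthSet (G0 : Set G) (B : Multiset G) : Set ℕ :=
  {k | ∃ U : Fin k → Multiset G, (∀ i, IsMinZeroSum G0 (U i)) ∧ B = ∑ i, U i}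

/-- The system of sets of lengths `𝓛(G₀)`. -/
def systemL (G0 : Set G) : Set (Set ℕ) :=
  {L | ∃ B : Multiset G, IsZeroSumSeq G0 B ∧ L = lengthSet G0 B}

/-- The Davenport constant `D(G)`: the maximal length of a minimal zero-sum
sequence over `G`. -/
noncomputable def davenport (G : Type*) [AddCommGroup G] : ℕ :=
  sSup {m | ∃ A : Multiset G, IsMinZeroSum (Set.univ : Set G) A ∧ Multiset.card A = m}

/-- The set of successive distances `Δ(L)` of a set `L ⊆ ℕ`. -/
def deltaOf (L : Set ℕ) : Set ℕ :=
  {d | 0 < d ∧ ∃ a, a ∈ L ∧ a + d ∈ L ∧ ∀ c ∈ L, ¬(a < c ∧ c < a + d)}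

/-- `Δ(G₀) = ⋃_{L ∈ 𝓛(G₀)} Δ(L)`. -/
def deltaG0 (G0 : Set G) : Set ℕ := ⋃ L ∈ systemL G0, deltaOf L

/-- `Δ*(G) = {min Δ(G₀) : G₀ ⊆ G with Δ(G₀) ≠ ∅}`. -/
def deltaStar (G : Type*) [AddCommGroup G] : Set ℕ :=
  {d | ∃ G0 : Set G, deltaG0 G0 ≠ ∅ ∧ d = sInf (deltaG0 G0)}

/-- The elasticity `ρ(L) = max L / min L` of a (finite) set `L ⊆ ℕ`,
with the convention `ρ({0}) = 1`. -/
noncomputable def rhoL (L : Set ℕ) : ℝ :=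
  if sInf L = 0 then 1 else ((sSup L : ℕ) : ℝ) / ((sInf L : ℕ) : ℝ)

/-- The elasticity `ρ(G₀) = sup {ρ(L) : L ∈ 𝓛(G₀)}`. -/
noncomputable def rhoG0 (G0 : Set G) : ℝ := sSup (rhoL '' systemL G0)

/-- `L` (a set of naturals) is an almost arithmetical progression (AAP)
with difference `d`, length `ℓ` and bound `M`:
`L = y + (L' ∪ {0, d, …, ℓd} ∪ L'') ⊆ y + dℤ` with `L' ⊆ [−M, −1]` and
`L'' ⊆ ℓd + [1, M]`. -/
def IsAAP (L : Set ℕ) (d ℓ M : ℕ) : Prop :=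
  ∃ (y : ℤ) (L1 L2 : Set ℤ),
    L1 ⊆ Set.Icc (-(M : ℤ)) (-1) ∧
    L2 ⊆ Set.Icc ((ℓ : ℤ) * d + 1) ((ℓ : ℤ) * d + M) ∧
    ((fun x : ℕ => (x : ℤ)) '' L) =
      (fun x => y + x) '' (L1 ∪ (fun i : ℤ => (d : ℤ) * i) '' Set.Icc (0 : ℤ) (ℓ : ℤ) ∪ L2) ∧
    (∀ x ∈ L, (d : ℤ) ∣ ((x : ℤ) - y))

/-- `Δ₁(G)`: the set of `d ∈ ℕ` such that for every `k` there is some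
`L ∈ 𝓛(G)` which is an AAP with difference `d` and length at least `k`. -/
def delta1 (G : Type*) [AddCommGroup G] : Set ℕ :=
  {d | 0 < d ∧ ∀ k : ℕ, ∃ L ∈ systemL (Set.univ : Set G), ∃ ℓ ≥ k, ∃ M : ℕ, IsAAP L d ℓ M}

/-- `ρ(G, d, k)`: the supremum of elasticities of sets of lengths of `G` which
are AAPs with difference `d` and length at least `k`. -/
noncomputable def rhoGdk (G : Type*) [AddCommGroup G] (d k : ℕ) : ℝ :=
  sSup (rhoL '' {L | L ∈ systemL (Set.univ : Set G) ∧ ∃ ℓ ≥ k, ∃ M : ℕ, IsAAP L d ℓ M})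

/-- `ρ(G, d)`: the limit of the decreasing sequence `(ρ(G, d, k))_k`,
i.e. its infimum. -/
noncomputable def rhoGd (G : Type*) [AddCommGroup G] (d : ℕ) : ℝ :=
  ⨅ k : ℕ, rhoGdk G d k

/-- `ρ*(G, d) = max {ρ(G₀) : G₀ ⊆ G non-half-factorial with d ∣ min Δ(G₀)}`. -/
noncomputable def rhoStar (G : Type*) [AddCommGroup G] (d : ℕ) : ℝ :=
  sSup {x | ∃ G0 : Set G, deltaG0 G0 ≠ ∅ ∧ d ∣ sInf (deltaG0 G0) ∧ x = rhoG0 G0}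

/-- The cross number `k(S) = Σ_{g ∈ S} 1/ord(g)` of a sequence `S`. -/
noncomputable def crossNum (S : Multiset G) : ℝ :=
  (S.map (fun g => (1 : ℝ) / (addOrderOf g))).sum

/-- `K(G₀) = max {k(A) : A ∈ 𝓐(G₀)}`, the cross number of `G₀`. -/
noncomputable def KG0 (G0 : Set G) : ℝ :=
  sSup {x | ∃ A : Multiset G, IsMinZeroSum G0 A ∧ x = crossNum A}

/-- `K(G, d) = max {K(G₀) : G₀ ⊆ G non-half-factorial with d ∣ min Δ(G₀)}`. -/
noncomputable def KGd (G : Type*) [AddCommGroup G] (d : ℕ) : ℝ :=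
  sSup {x | ∃ G0 : Set G, deltaG0 G0 ≠ ∅ ∧ d ∣ sInf (deltaG0 G0) ∧ x = KG0 G0}

/-- `G₀` is an LCN-set: `k(A) ≥ 1` for every atom `A` of `𝓑(G₀)`. -/
def IsLCN (G0 : Set G) : Prop :=
  ∀ A : Multiset G, IsMinZeroSum G0 A → 1 ≤ crossNum A

end Defs

section Helpers

variable {G : Type*} [AddCommGroup G]

lemma ls_zero (G0 : Set G) : 0 ∈ lengthSet G0 0 := ⟨fun i => i.elim0, fun i => i.elim0, by simp⟩

lemma ls_atom {G0 : Set G} {A : Multiset G} (h : IsMinZeroSum G0 A) : 1 ∈ lengthSet G0 A :=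
  ⟨fun _ => A, fun _ => h, by simp⟩

lemma ls_add {G0 : Set G} {B C : Multiset G} {k l : ℕ} (h : k ∈ lengthSet G0 B)
    (h' : l ∈ lengthSet G0 C) : k + l ∈ lengthSet G0 (B + C) := by
  obtain ⟨U, hU, rfl⟩ := h
  obtain ⟨V, hV, rfl⟩ := h'
  refine ⟨Fin.append U V, fun i => ?_, ?_⟩
  · refine Fin.addCases (fun i => ?_) (fun i => ?_) i
    · simpa using hU i
    · simpa using hV i
  · rw [Fin.sum_univ_add]; simp

lemma ls_nsmul {G0 : Set G} {A : Multiset G} (h : IsMinZeroSum G0 A) (c : ℕ) :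
    c ∈ lengthSet G0 (c • A) := by
  induction c with
  | zero => simpa using ls_zero G0
  | succ c ih => rw [succ_nsmul]; exact ls_add ih (ls_atom h)

lemma atom_replicate [Finite G] {G0 : Set G} {g : G} (hg : g ∈ G0) :
    IsMinZeroSum G0 (Multiset.replicate (addOrderOf g) g) := by
  refine ⟨?_, ?_, ?_, ?_⟩
  · intro h
    have := congrArg Multiset.card h
    simp only [Multiset.card_replicate, Multiset.card_zero] at this
    exact (addOrderOf_pos g).ne' this
  · intro x hx; rw [Multiset.eq_of_mem_replicate hx]; exact hg
  · simp [addOrderOf_nsmul_eq_zero]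
  · intro T hT hs
    obtain ⟨j, hj, rfl⟩ := Multiset.le_replicate_iff.1 hT
    simp only [Multiset.sum_replicate] at hs
    have hd := addOrderOf_dvd_of_nsmul_eq_zero hs
    rcases Nat.eq_zero_or_pos j with h0 | h0
    · left; simp [h0]
    · right; rw [le_antisymm hj (Nat.le_of_dvd h0 hd)]

lemma ls_cross [Fintype G] {G0 : Set G} (S : Multiset G) (hS : ∀ g ∈ S, g ∈ G0) :
    ∃ M ∈ lengthSet G0 (Fintype.card G • S), (M : ℝ) = Fintype.card G * crossNum S := by
  induction S using Multiset.induction_on with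
  | empty => exact ⟨0, by simpa using ls_zero G0, by simp [crossNum]⟩
  | cons g S ih =>
    obtain ⟨M, hM, hM'⟩ := ih (fun x hx => hS x (Multiset.mem_cons_of_mem hx))
    obtain ⟨q, hq⟩ := addOrderOf_dvd_card (x := g)
    refine ⟨q + M, ?_, ?_⟩
    · have : Fintype.card G • (g ::ₘ S) = q • Multiset.replicate (addOrderOf g) g
          + Fintype.card G • S := by
        rw [← Multiset.singleton_add, nsmul_add, Multiset.nsmul_singleton,
          Multiset.nsmul_replicate, hq, mul_comm]
      rw [this]
      exact ls_add (ls_nsmul (atom_replicate (hS g (Multiset.mem_cons_self g S))) q) hM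
    · have h0 : (addOrderOf g : ℝ) ≠ 0 := by exact_mod_cast (addOrderOf_pos g).ne'
      have : crossNum (g ::ₘ S) = 1 / (addOrderOf g : ℝ) + crossNum S := by simp [crossNum]
      rw [this, mul_add, ← hM', hq]
      push_cast
      field_simp

lemma atom_card_le [Fintype G] {G0 : Set G} {A : Multiset G} (h : IsMinZeroSum G0 A) :
    Multiset.card A ≤ Fintype.card G := by
  obtain ⟨l, rfl⟩ := Quot.exists_rep A
  obtain ⟨-, -, -, hmin⟩ := h
  change Multiset.card (l : Multiset G) ≤ _
  have key : ∀ i j : ℕ, i < j → j < l.length → (l.take i).sum ≠ (l.take j).sum := by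
    intro i j hij hj hs
    have h1 : (l.take i) ++ (l.take j).drop i = l.take j := by
      conv_rhs => rw [← List.take_append_drop i (l.take j)]
      rw [List.take_take, min_eq_left hij.le]
    have h2 : ((l.take j).drop i).sum = 0 := by
      have := congrArg List.sum h1
      rw [List.sum_append, hs] at this
      simpa using this
    have h3 : (((l.take j).drop i : List G) : Multiset G) ≤ (l : Multiset G) :=
      Multiset.coe_le.2 (((List.drop_sublist _ _).trans (List.take_sublist _ _)).subperm)
    have h4 : ((l.take j).drop i).length = j - i := by
      simp [min_eq_left hj.le]
    rcases hmin _ h3 (by simpa using h2) with h5 | h5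
    · have := congrArg Multiset.card h5
      simp only [Multiset.coe_card, h4, Multiset.card_zero] at this
      omega
    · have := congrArg Multiset.card h5
      simp only [Multiset.coe_card, h4] at this
      have e : Multiset.card (Quot.mk _ l : Multiset G) = l.length := rfl
      rw [e] at this
      omega
  have inj : Function.Injective (fun i : Fin l.length => (l.take i).sum) := by
    intro i j hij
    by_contra hne
    rcases lt_or_gt_of_ne hne with hlt | hlt
    · exact key i j hlt j.2 hij
    · exact key j i hlt i.2 hij.symm
  simpa using Fintype.card_le_of_injective _ inj

lemma ls_le_card {G0 : Set G} {B : Multiset G} {k : ℕ} (h : k ∈ lengthSet G0 B) :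
    k ≤ Multiset.card B := by
  obtain ⟨U, hU, rfl⟩ := h
  rw [Multiset.card_sum]
  calc k = ∑ _i : Fin k, 1 := by simp
    _ ≤ _ := Finset.sum_le_sum fun i _ => Multiset.card_pos.2 (hU i).1

lemma card_le_ls [Fintype G] {G0 : Set G} {B : Multiset G} {k : ℕ} (h : k ∈ lengthSet G0 B) :
    Multiset.card B ≤ k * Fintype.card G := by
  obtain ⟨U, hU, rfl⟩ := h
  rw [Multiset.card_sum]
  calc _ ≤ ∑ _i : Fin k, Fintype.card G := Finset.sum_le_sum fun i _ => atom_card_le (hU i)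
    _ = _ := by simp

lemma rhoL_nonneg (L : Set ℕ) : 0 ≤ rhoL L := by
  unfold rhoL; split_ifs <;> positivity

lemma rhoL_le [Fintype G] (G0 : Set G) (B : Multiset G) :
    rhoL (lengthSet G0 B) ≤ Fintype.card G := by
  unfold rhoL
  have hc : 1 ≤ Fintype.card G := Fintype.card_pos
  split_ifs with h0
  · exact_mod_cast hc
  · have hne : (lengthSet G0 B).Nonempty := Nat.nonempty_of_pos_sInf (Nat.pos_of_ne_zero h0)
    have h1 := card_le_ls (Nat.sInf_mem hne)
    have h2 : sSup (lengthSet G0 B) ≤ Multiset.card B := csSup_le hne fun k hk => ls_le_card hk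
    rw [div_le_iff₀ (by exact_mod_cast Nat.pos_of_ne_zero h0)]
    have := h2.trans h1
    rw [mul_comm] at this
    exact_mod_cast this

lemma rho_bdd [Fintype G] (G0 : Set G) : BddAbove (rhoL '' systemL G0) := by
  refine ⟨Fintype.card G, ?_⟩
  rintro _ ⟨_, ⟨B, -, rfl⟩, rfl⟩
  exact rhoL_le G0 B

lemma rhoG0_le [Fintype G] (G0 : Set G) : rhoG0 G0 ≤ Fintype.card G := by
  refine Real.sSup_le ?_ (by positivity)
  rintro _ ⟨_, ⟨B, -, rfl⟩, rfl⟩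
  exact rhoL_le G0 B

lemma rhoG0_nonneg (G0 : Set G) : 0 ≤ rhoG0 G0 := by
  refine Real.sSup_nonneg ?_
  rintro _ ⟨_, -, rfl⟩
  exact rhoL_nonneg _

lemma cross_le_rho [Fintype G] {G0 : Set G} {A : Multiset G} (h : IsMinZeroSum G0 A) :
    crossNum A ≤ rhoG0 G0 := by
  obtain ⟨M, hM, hM'⟩ := ls_cross A h.2.1
  have hN := ls_nsmul h (Fintype.card G)
  have hc : 0 < Fintype.card G := Fintype.card_pos
  have hsys : lengthSet G0 (Fintype.card G • A) ∈ systemL G0 := by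
    refine ⟨_, ⟨fun g hg => h.2.1 g (Multiset.mem_of_mem_nsmul hg), ?_⟩, rfl⟩
    rw [Multiset.sum_nsmul, h.2.2.1, nsmul_zero]
  refine le_trans ?_ (le_csSup (rho_bdd G0) ⟨_, hsys, rfl⟩)
  set L := lengthSet G0 (Fintype.card G • A) with hL
  have hi : sInf L ≤ Fintype.card G := Nat.sInf_le hN
  have hs : M ≤ sSup L := le_csSup ⟨_, fun k hk => ls_le_card hk⟩ hM
  have h0 : sInf L ≠ 0 := by
    intro h0
    have := Nat.sInf_mem ⟨_, hN⟩
    rw [h0] at this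
    have h1 := card_le_ls this
    simp only [zero_mul, Multiset.card_nsmul, nonpos_iff_eq_zero, mul_eq_zero,
      Multiset.card_eq_zero] at h1
    rcases h1 with h1 | h1
    · omega
    · exact h.1 h1
  unfold rhoL
  rw [if_neg h0, le_div_iff₀ (by exact_mod_cast Nat.pos_of_ne_zero h0)]
  have hk : 0 ≤ crossNum A := by
    unfold crossNum
    refine Multiset.sum_nonneg ?_
    intro x hx
    obtain ⟨g, -, rfl⟩ := Multiset.mem_map.1 hx
    positivity
  calc crossNum A * (sInf L : ℕ) ≤ crossNum A * Fintype.card G :=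
        mul_le_mul_of_nonneg_left (by exact_mod_cast hi) hk
    _ = M := by rw [hM', mul_comm]
    _ ≤ _ := by exact_mod_cast hs

lemma KG0_le_rhoG0 [Fintype G] (G0 : Set G) : KG0 G0 ≤ rhoG0 G0 := by
  refine Real.sSup_le ?_ (rhoG0_nonneg G0)
  rintro _ ⟨A, hA, rfl⟩
  exact cross_le_rho hA

lemma KGd_le_rhoStar [Fintype G] (d : ℕ) : KGd G d ≤ rhoStar G d := by
  refine Real.sSup_le ?_ ?_
  · rintro _ ⟨G0, h1, h2, rfl⟩
    refine (KG0_le_rhoG0 G0).trans (le_csSup ⟨Fintype.card G, ?_⟩ ⟨G0, h1, h2, rfl⟩)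
    rintro _ ⟨G1, -, -, rfl⟩
    exact rhoG0_le G1
  · refine Real.sSup_nonneg ?_
    rintro _ ⟨G1, -, -, rfl⟩
    exact rhoG0_nonneg G1

lemma cross_le_KGd [Fintype G] {d : ℕ} {G0 : Set G} (h1 : deltaG0 G0 ≠ ∅)
    (h2 : d ∣ sInf (deltaG0 G0)) {A : Multiset G} (hA : IsMinZeroSum G0 A) :
    crossNum A ≤ KGd G d := by
  have a : crossNum A ≤ KG0 G0 := by
    refine le_csSup ⟨rhoG0 G0, ?_⟩ ⟨A, hA, rfl⟩
    rintro _ ⟨A, hA, rfl⟩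
    exact cross_le_rho hA
  refine a.trans (le_csSup ⟨Fintype.card G, ?_⟩ ⟨G0, h1, h2, rfl⟩)
  rintro _ ⟨G1, -, -, rfl⟩
  exact (KG0_le_rhoG0 G1).trans (rhoG0_le G1)

lemma deltaOf_nonempty {L : Set ℕ} {a b : ℕ} (ha : a ∈ L) (hb : b ∈ L) (hab : a < b) :
    (deltaOf L).Nonempty := by
  have hex : ∃ k, 0 < k ∧ a + k ∈ L := ⟨b - a, by omega, by rwa [Nat.add_sub_cancel' hab.le]⟩
  refine ⟨Nat.find hex, (Nat.find_spec hex).1, a, ha, (Nat.find_spec hex).2, ?_⟩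
  rintro c hc ⟨h1, h2⟩
  refine Nat.find_min hex (m := c - a) (by omega) ⟨by omega, ?_⟩
  rwa [Nat.add_sub_cancel' h1.le]

lemma delta_nonempty [Fintype G] {G0 : Set G} {A : Multiset G} (h : IsMinZeroSum G0 A)
    (h1 : 1 < crossNum A) : deltaG0 G0 ≠ ∅ := by
  obtain ⟨M, hM, hM'⟩ := ls_cross A h.2.1
  have hN := ls_nsmul h (Fintype.card G)
  have hc : (0 : ℝ) < Fintype.card G := by exact_mod_cast Fintype.card_pos
  have hlt : Fintype.card G < M := by
    have : (Fintype.card G : ℝ) < M := by rw [hM']; nlinarith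
    exact_mod_cast this
  obtain ⟨x, hx⟩ := deltaOf_nonempty hN hM hlt
  refine Set.Nonempty.ne_empty ⟨x, ?_⟩
  unfold deltaG0
  simp only [Set.mem_iUnion]
  refine ⟨_, ⟨_, ⟨fun g hg => h.2.1 g (Multiset.mem_of_mem_nsmul hg), ?_⟩, rfl⟩, hx⟩
  rw [Multiset.sum_nsmul, h.2.2.1, nsmul_zero]

/-- The main construction. -/
lemma construction [Fintype G] (d m : ℕ) (hd : 0 < d) (hm : 1 < m) (e : Fin (d + 1) → G)
    (hord : ∀ i, m • e i = 0)
    (hind : ∀ c : Fin (d + 1) → ℕ, ∑ i, c i • e i = 0 → ∀ i, m ∣ c i) :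
    1 + ((m : ℝ) - 1) * (d : ℝ) / (m : ℝ) ≤ KGd G d := by
  set e0 : G := ∑ i, e i with he0
  have hneg : ∀ i, (m - 1) • e i = - e i := by
    intro i
    rw [eq_neg_iff_add_eq_zero, ← succ_nsmul, Nat.sub_add_cancel hm.le, hord]
  have hord0 : m • e0 = 0 := by
    rw [he0, Finset.smul_sum]; exact Finset.sum_eq_zero fun i _ => hord i
  have ndvd : ¬ m ∣ 1 := by rw [Nat.dvd_one]; omega
  have hinj : Function.Injective e := by
    intro i j hij
    by_contra hne
    have := hind (Pi.single i 1 + Pi.single j (m - 1)) (by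
      simp only [Pi.add_apply, add_smul, Finset.sum_add_distrib, Pi.single_apply, ite_smul,
        zero_smul, Finset.sum_ite_eq', Finset.mem_univ, if_true, one_smul, hneg, hij]
      simp) i
    simp [Pi.single_apply, hne] at this
    omega
  have hne0 : ∀ i, e i ≠ e0 := by
    intro i hi
    have : Nontrivial (Fin (d + 1)) := Fin.nontrivial_iff_two_le.2 (by omega)
    obtain ⟨j, hj⟩ := exists_ne i
    have := hind ((fun _ => 1) + Pi.single i (m - 1)) (by
      simp only [Pi.add_apply, add_smul, Finset.sum_add_distrib, Pi.single_apply, ite_smul,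
        zero_smul, Finset.sum_ite_eq', Finset.mem_univ, if_true, one_smul, hneg, hi, ← he0]
      simp) j
    simp [Pi.single_apply, hj] at this
    omega
  have ho : ∀ i, addOrderOf (e i) = m := by
    intro i
    refine Nat.dvd_antisymm (addOrderOf_dvd_of_nsmul_eq_zero (hord i)) ?_
    have := hind (Pi.single i (addOrderOf (e i))) (by
      simp only [Pi.single_apply, ite_smul, zero_smul, Finset.sum_ite_eq', Finset.mem_univ,
        if_true, addOrderOf_nsmul_eq_zero]) i
    simpa using this
  have ho0 : addOrderOf e0 = m := by
    refine Nat.dvd_antisymm (addOrderOf_dvd_of_nsmul_eq_zero hord0) ?_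
    refine hind (fun _ => addOrderOf e0) ?_ 0
    rw [← Finset.smul_sum, ← he0, addOrderOf_nsmul_eq_zero]
  set S : Finset G := insert e0 (Finset.univ.image e) with hS
  have hnot : e0 ∉ Finset.univ.image e := by simpa using hne0
  set G0 : Set G := (S : Set G) with hG0
  have hcard : ∀ A : Multiset G, (∀ g ∈ A, g ∈ G0) →
      Multiset.card A = A.count e0 + ∑ i, A.count (e i) := by
    intro A hA
    rw [← Multiset.sum_count_eq_card (s := S) (fun a ha => hA a ha)]
    rw [hS, Finset.sum_insert hnot, Finset.sum_image (fun a _ b _ h => hinj h)]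
  have hdiv : ∀ A : Multiset G, (∀ g ∈ A, g ∈ G0) → A.sum = 0 →
      ∀ i, m ∣ A.count e0 + A.count (e i) := by
    intro A hA hs
    refine hind (fun i => A.count e0 + A.count (e i)) ?_
    simp only [add_smul, Finset.sum_add_distrib]
    rw [← Finset.smul_sum, ← he0]
    rw [Finset.sum_multiset_count_of_subset A S
      (fun a ha => hA a (Multiset.mem_toFinset.1 ha))] at hs
    rw [← hs]
    rw [hS, Finset.sum_insert hnot, Finset.sum_image (fun a _ b _ h => hinj h)]
  have he0S : e0 ∈ G0 := by simp [hG0, hS]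
  have heS : ∀ i, e i ∈ G0 := by simp [hG0, hS]
  -- all atoms have weight `m` modulo `m * d`
  have hw : ∀ A : Multiset G, IsMinZeroSum G0 A →
      (m * d : ℤ) ∣ (Multiset.card A : ℤ) - d * A.count (e 0) - m := by
    rintro A ⟨hA0, hAG, hAs, hmin⟩
    have big : ∀ g, m • g = 0 → m ≤ A.count g → A = Multiset.replicate m g := by
      intro g hg hc
      rcases hmin _ (Multiset.le_count_iff_replicate_le.1 hc) (by simpa using hg) with h | h
      · have := congrArg Multiset.card h
        simp at this
        omega
      · exact h.symm
    by_cases c0 : m ≤ A.count e0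
    · rw [big e0 hord0 c0]
      simp [Multiset.count_replicate, (hne0 0).symm]
    by_cases c1 : ∃ i, m ≤ A.count (e i)
    · obtain ⟨i, hi⟩ := c1
      rw [big _ (hord i) hi]
      by_cases h : i = 0
      · subst h
        simp only [Multiset.card_replicate, Multiset.count_replicate_self]
        exact ⟨-1, by ring⟩
      · simp [Multiset.count_replicate, hinj.eq_iff, h]
    push Not at c0 c1
    have hdv := hdiv A hAG hAs
    have hpos : 0 < A.count e0 := by
      by_contra h
      have h : A.count e0 = 0 := by omega
      apply hA0
      rw [← Multiset.card_eq_zero, hcard A hAG, h, zero_add]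
      refine Finset.sum_eq_zero fun i _ => ?_
      have := hdv i
      rw [h, zero_add] at this
      exact Nat.eq_zero_of_dvd_of_lt this (c1 i)
    have hval : ∀ i, A.count (e i) = m - A.count e0 := by
      intro i
      obtain ⟨q, hq⟩ := hdv i
      have := c1 i
      have q1 : q = 1 := by
        have : 0 < q := by
          rcases Nat.eq_zero_or_pos q with h | h
          · subst h; omega
          · exact h
        have : q < 2 := by
          by_contra h
          have : m * 2 ≤ m * q := Nat.mul_le_mul_left m (by omega)
          omega
        omega
      subst q1
      omega
    rw [hcard A hAG]
    simp only [hval]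
    rw [Finset.sum_const, Finset.card_univ, Fintype.card_fin, smul_eq_mul]
    push_cast [Nat.cast_sub c0.le]
    exact ⟨0, by ring⟩
  have hwl : ∀ (B : Multiset G) (k : ℕ), k ∈ lengthSet G0 B →
      (m * d : ℤ) ∣ (Multiset.card B : ℤ) - d * B.count (e 0) - m * k := by
    rintro B k ⟨U, hU, rfl⟩
    have : ((Multiset.card (∑ i, U i) : ℕ) : ℤ) - d * ((∑ i, U i).count (e 0) : ℕ) - m * k
        = ∑ i, ((Multiset.card (U i) : ℤ) - d * (U i).count (e 0) - m) := by
      rw [Multiset.card_sum, Multiset.count_sum']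
      push_cast
      simp only [Finset.sum_sub_distrib, Finset.mul_sum, Finset.sum_const, Finset.card_univ,
        Fintype.card_fin, nsmul_eq_mul]
      ring
    rw [this]
    exact Finset.dvd_sum fun i _ => hw _ (hU i)
  have hddvd : ∀ x ∈ deltaG0 G0, d ∣ x := by
    intro x hx
    unfold deltaG0 at hx
    simp only [Set.mem_iUnion] at hx
    obtain ⟨L, ⟨B, -, rfl⟩, -, a, ha, hb, -⟩ := hx
    obtain ⟨u, hu⟩ := hwl B _ ha
    obtain ⟨v, hv⟩ := hwl B _ hb
    have h' : (m * d : ℤ) ∣ m * x := by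
      refine ⟨u - v, ?_⟩
      push_cast at hv
      linear_combination hu - hv
    have := Int.dvd_of_mul_dvd_mul_left (by omega) h'
    exact_mod_cast this
  -- the atom of large cross number
  set W : Multiset G := {e0} + (m - 1) • ∑ i, {e i} with hW
  have hWc0 : W.count e0 = 1 := by
    rw [hW, Multiset.count_add, Multiset.count_nsmul, Multiset.count_sum']
    simp [Multiset.count_singleton, (hne0 _).symm]
  have hWci : ∀ i, W.count (e i) = m - 1 := by
    intro i
    rw [hW, Multiset.count_add, Multiset.count_nsmul, Multiset.count_sum']
    simp [Multiset.count_singleton, hne0, hinj.eq_iff]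
  have hWG : ∀ g ∈ W, g ∈ G0 := by
    intro g hg
    rw [hW, Multiset.mem_add] at hg
    rcases hg with hg | hg
    · rw [Multiset.mem_singleton] at hg; rw [hg]; exact he0S
    · have := Multiset.mem_of_mem_nsmul hg
      rw [Multiset.mem_sum] at this
      obtain ⟨i, -, hi⟩ := this
      rw [Multiset.mem_singleton] at hi; rw [hi]; exact heS i
  have hWs : W.sum = 0 := by
    rw [hW, Multiset.sum_add, Multiset.sum_nsmul, Multiset.sum_singleton, Multiset.sum_sum]
    simp only [Multiset.sum_singleton]
    rw [← he0, ← succ_nsmul', Nat.sub_add_cancel hm.le, hord0]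
  have hWat : IsMinZeroSum G0 W := by
    refine ⟨?_, hWG, hWs, ?_⟩
    · intro h; rw [h] at hWc0; simp at hWc0
    · intro T hT hTs
      have hTG : ∀ g ∈ T, g ∈ G0 := fun g hg => hWG g (Multiset.mem_of_le hT hg)
      have t0 : T.count e0 ≤ 1 := hWc0 ▸ Multiset.count_le_of_le e0 hT
      have ti : ∀ i, T.count (e i) ≤ m - 1 := fun i => hWci i ▸ Multiset.count_le_of_le (e i) hT
      have hdv := hdiv T hTG hTs
      rcases Nat.eq_zero_or_pos (T.count e0) with h | h
      · left
        rw [← Multiset.card_eq_zero, hcard T hTG, h, zero_add]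
        refine Finset.sum_eq_zero fun i _ => ?_
        have := hdv i
        rw [h, zero_add] at this
        exact Nat.eq_zero_of_dvd_of_lt this (by have := ti i; omega)
      · right
        have h1 : T.count e0 = 1 := by omega
        refine Multiset.eq_of_le_of_card_le hT ?_
        rw [hcard T hTG, hcard W hWG, hWc0, h1]
        refine Nat.add_le_add_left (Finset.sum_le_sum fun i _ => ?_) _
        rw [hWci]
        have := Nat.le_of_dvd (by omega) (hdv i)
        omega
  have hWk : crossNum W = 1 + ((m : ℝ) - 1) * (d : ℝ) / (m : ℝ) := by
    have h1 : crossNum W = (Multiset.card W : ℝ) * (1 / (m : ℝ)) := by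
      unfold crossNum
      rw [Multiset.map_congr rfl (g := fun _ => 1 / (m : ℝ))]
      · simp
      · intro g hg
        have := hWG g hg
        rw [hG0, hS] at this
        simp only [Finset.coe_insert, Finset.coe_image, Finset.coe_univ, Set.image_univ,
          Set.mem_insert_iff, Set.mem_range] at this
        rcases this with rfl | ⟨i, rfl⟩
        · rw [ho0]
        · rw [ho]
    have h2 : Multiset.card W = 1 + (d + 1) * (m - 1) := by
      rw [hcard W hWG, hWc0]
      simp [hWci]
    have hm0 : (m : ℝ) ≠ 0 := by positivity
    rw [h1, h2]
    push_cast [Nat.cast_sub hm.le]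
    field_simp
    ring
  have hgt : 1 < crossNum W := by
    rw [hWk]
    have : (1 : ℝ) < m := by exact_mod_cast hm
    have : (0 : ℝ) < d := by exact_mod_cast hd
    have : 0 < ((m : ℝ) - 1) * (d : ℝ) / (m : ℝ) := by
      apply div_pos (mul_pos _ _) <;> linarith
    linarith
  have hne := delta_nonempty hWat hgt
  rw [← hWk]
  exact cross_le_KGd hne (hddvd _ (Nat.sInf_mem (Set.nonempty_iff_ne_empty.2 hne))) hWat

end Helpers

/-- Suppose `G ≅ C_{n₁} ⊕ … ⊕ C_{n_r}` with `1 < n₁ ∣ … ∣ n_r`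
and `D(G) ≥ 4`. For every `d ∈ Δ₁(G)`, `ρ*(G, d) ≥ K(G, d)`; and if moreover
`d ∈ [1, r−1]`, then `ρ*(G, d) ≥ K(G, d) ≥ 1 + (n₁ − 1)d/n₁ ≥ 1 + d/2`. -/
theorem stmt13 {G : Type*} [AddCommGroup G] [Fintype G]
    (r : ℕ) (hr : 0 < r) (n : Fin r → ℕ) (hn : ∀ i, 1 < n i)
    (hdvd : ∀ i j : Fin r, i ≤ j → n i ∣ n j)
    (hG : Nonempty (G ≃+ (∀ i : Fin r, ZMod (n i))))
    (hD : 4 ≤ davenport G)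
 :
    (∀ d ∈ delta1 G, KGd G d ≤ rhoStar G d) ∧
    (∀ d ∈ delta1 G, d ≤ r - 1 →
      1 + (d : ℝ) / 2 ≤ 1 + ((n ⟨0, hr⟩ : ℝ) - 1) * (d : ℝ) / (n ⟨0, hr⟩ : ℝ) ∧
      1 + ((n ⟨0, hr⟩ : ℝ) - 1) * (d : ℝ) / (n ⟨0, hr⟩ : ℝ) ≤ KGd G d ∧
      KGd G d ≤ rhoStar G d) := by
  refine ⟨fun d _ => KGd_le_rhoStar d, fun d hd hdr => ⟨?_, ?_, KGd_le_rhoStar d⟩⟩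
  · have h2 : (2 : ℝ) ≤ n ⟨0, hr⟩ := by exact_mod_cast hn ⟨0, hr⟩
    have hd0 : (0 : ℝ) ≤ d := by positivity
    have : (d : ℝ) / 2 ≤ ((n ⟨0, hr⟩ : ℝ) - 1) * (d : ℝ) / (n ⟨0, hr⟩ : ℝ) := by
      rw [div_le_div_iff₀ (by norm_num) (by linarith)]
      nlinarith
    linarith
  · have hdpos : 0 < d := hd.1
    obtain ⟨φ⟩ := hG
    set m := n ⟨0, hr⟩ with hm
    have hle : d + 1 ≤ r := by omega
    have hmd : ∀ j, m ∣ n j := fun j => hdvd _ _ (Fin.mk_le_of_le_val (Nat.zero_le _))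
    refine construction d m hdpos (hn _)
      (fun i => φ.symm (Pi.single (Fin.castLE hle i)
        ((n (Fin.castLE hle i) / m : ℕ) : ZMod (n (Fin.castLE hle i))))) ?_ ?_
    · intro i
      rw [← map_nsmul, ← Pi.single_smul, nsmul_eq_mul, ← Nat.cast_mul,
        Nat.mul_div_cancel' (hmd _), ZMod.natCast_self]
      simp
    · intro c hc i
      have h := congrFun (congrArg φ hc) (Fin.castLE hle i)
      rw [map_sum, map_zero, Finset.sum_apply, Finset.sum_eq_single i] at h
      · rw [map_nsmul, AddEquiv.apply_symm_apply, Pi.smul_apply, Pi.single_eq_same, nsmul_eq_mul,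
          ← Nat.cast_mul, Pi.zero_apply, ZMod.natCast_eq_zero_iff] at h
        have h3 := hmd (Fin.castLE hle i)
        have h4 := hn (Fin.castLE hle i)
        have hpos : 0 < n (Fin.castLE hle i) / m :=
          Nat.div_pos (Nat.le_of_dvd (by omega) h3) (by have := hn ⟨0, hr⟩; omega)
        refine Nat.dvd_of_mul_dvd_mul_right hpos ?_
        rwa [Nat.mul_div_cancel' h3]
      · intro j _ hj
        rw [map_nsmul, AddEquiv.apply_symm_apply, Pi.smul_apply, Pi.single_eq_of_ne, smul_zero]
        intro h
        exact hj (Fin.castLE_injective hle h).symm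
      · simp
end

section
/- Let G be a finite abelian group with D(G) ≥ 4 and let G0 ⊆ G be a subset with Δ(G0) ≠ ∅. Then min Δ(G0) ∈ Δ1(G), and for every B ∈ B(G0) with min Δ(G0) ∈ Δ(L(B)) one has ρ(G, min Δ(G0)) ≥ ρ(L(B)). -/
/- Common definitions: zero-sum sequences over a finite abelian group,
   sets of lengths, the system of sets of lengths, the Davenport constant,
   sets of distances, elasticities, AAPs, Δ₁(G), ρ(G,d,k), ρ(G,d), ρ*(G,d),
   cross numbers, K(G₀), K(G,d), LCN-sets, Δ*(G). -/

open scoped Classical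

section Helpers

variable {G : Type*} [AddCommGroup G]

lemma aux_add {G0 : Set G} {B C : Multiset G} {k l : ℕ}
    (hk : k ∈ lengthSet G0 B) (hl : l ∈ lengthSet G0 C) : k + l ∈ lengthSet G0 (B + C) := by
  obtain ⟨U, hU, rfl⟩ := hk
  obtain ⟨V, hV, rfl⟩ := hl
  refine ⟨Fin.append U V, ?_, ?_⟩
  · intro i
    refine Fin.addCases (fun i => ?_) (fun i => ?_) i
    · simpa using hU i
    · simpa using hV i
  · simp [Fin.sum_univ_add]

lemma aux_nsmul {G0 : Set G} {B : Multiset G} {k : ℕ}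
    (hk : k ∈ lengthSet G0 B) (n : ℕ) : n * k ∈ lengthSet G0 (n • B) := by
  induction n with
  | zero => exact ⟨fun i => 0, fun i => absurd i.2 (by simp), by simp⟩
  | succ n ih =>
    rw [succ_nsmul, Nat.succ_mul]
    exact aux_add ih hk

lemma aux_zs_nsmul {G0 : Set G} {B : Multiset G} (h : IsZeroSumSeq G0 B) (n : ℕ) :
    IsZeroSumSeq G0 (n • B) :=
  ⟨fun g hg => h.1 g (Multiset.mem_of_mem_nsmul hg), by
    rw [Multiset.sum_nsmul, h.2, smul_zero]⟩

lemma aux_zs_add {G0 : Set G} {B C : Multiset G} (h : IsZeroSumSeq G0 B)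
    (h' : IsZeroSumSeq G0 C) : IsZeroSumSeq G0 (B + C) :=
  ⟨fun g hg => (Multiset.mem_add.1 hg).elim (h.1 g) (h'.1 g), by
    rw [Multiset.sum_add, h.2, h'.2, add_zero]⟩

lemma aux_univ {G0 : Set G} {B : Multiset G} (h : IsZeroSumSeq G0 B) :
    lengthSet (Set.univ : Set G) B = lengthSet G0 B := by
  ext k
  constructor
  · rintro ⟨U, hU, hB⟩
    refine ⟨U, fun i => ⟨(hU i).1, fun g hg => h.1 g ?_, (hU i).2.2⟩, hB⟩
    rw [hB]
    exact Multiset.mem_sum.2 ⟨i, Finset.mem_univ i, hg⟩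
  · rintro ⟨U, hU, hB⟩
    exact ⟨U, fun i => ⟨(hU i).1, fun g hg => Set.mem_univ g, (hU i).2.2⟩, hB⟩

lemma aux_le_card {G0 : Set G} {B : Multiset G} {k : ℕ} (hk : k ∈ lengthSet G0 B) :
    k ≤ Multiset.card B := by
  obtain ⟨U, hU, rfl⟩ := hk
  rw [Multiset.card_sum]
  calc k = ∑ i : Fin k, 1 := by simp
    _ ≤ _ := Finset.sum_le_sum fun i _ => Multiset.card_pos.2 (hU i).1

lemma aux_card_le {G0 : Set G} {B : Multiset G} {k D : ℕ}
    (hD : ∀ A, IsMinZeroSum G0 A → Multiset.card A ≤ D)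
    (hk : k ∈ lengthSet G0 B) : Multiset.card B ≤ k * D := by
  obtain ⟨U, hU, rfl⟩ := hk
  rw [Multiset.card_sum]
  calc _ ≤ ∑ i : Fin k, D := Finset.sum_le_sum fun i _ => hD _ (hU i)
    _ = k * D := by simp

lemma aux_bdd (G0 : Set G) (B : Multiset G) : BddAbove (lengthSet G0 B) :=
  ⟨Multiset.card B, fun _ hk => aux_le_card hk⟩

/-- all atoms have length at most the Davenport constant -/
lemma aux_dav (hD : 4 ≤ davenport G) (A : Multiset G)
    (hA : IsMinZeroSum (Set.univ : Set G) A) : Multiset.card A ≤ davenport G := by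
  have hb : BddAbove {m | ∃ A : Multiset G, IsMinZeroSum (Set.univ : Set G) A ∧
      Multiset.card A = m} := by
    by_contra hb
    have h0 : davenport G = 0 := by
      unfold davenport
      exact Nat.sSup_of_not_bddAbove hb
    omega
  exact le_csSup hb ⟨A, hA, rfl⟩

lemma aux_rho_le (hD : 4 ≤ davenport G) (B : Multiset G) :
    rhoL (lengthSet (Set.univ : Set G) B) ≤ davenport G := by
  unfold rhoL
  split_ifs with h
  · exact_mod_cast (by omega : 1 ≤ davenport G)
  · have hne : (lengthSet (Set.univ : Set G) B).Nonempty := by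
      by_contra hn
      rw [Set.not_nonempty_iff_eq_empty] at hn
      exact h (by rw [hn]; simp)
    have h1 := Nat.sInf_mem hne
    have h2 := Nat.sSup_mem hne (aux_bdd _ _)
    have h3 := aux_le_card h2
    have h4 := aux_card_le (aux_dav hD) h1
    rw [div_le_iff₀ (by exact_mod_cast Nat.pos_of_ne_zero h), mul_comm]
    exact_mod_cast h3.trans h4

/-- a positive difference of two lengths is at least `min Δ` -/
lemma aux_min {G0 : Set G} {B : Multiset G} (hB : IsZeroSumSeq G0 B) {x y : ℕ}
    (hx : x ∈ lengthSet G0 B) (hy : y ∈ lengthSet G0 B) (h : y < x) :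
    sInf (deltaG0 G0) ≤ x - y := by
  have hex : ∃ c, c ∈ lengthSet G0 B ∧ y < c := ⟨x, hx, h⟩
  have hc := Nat.find_spec hex
  have hmin := fun m => Nat.find_min (m := m) hex
  have hle : Nat.find hex ≤ x := Nat.find_min' hex ⟨hx, h⟩
  generalize Nat.find hex = c at *
  have : c - y ∈ deltaG0 G0 := by
    refine Set.mem_biUnion (x := lengthSet G0 B) ⟨B, hB, rfl⟩ ⟨by omega, y, hy, ?_, ?_⟩
    · rw [Nat.add_sub_cancel' hc.2.le]; exact hc.1
    · rintro e he ⟨h1, h2⟩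
      exact hmin e (by omega) ⟨he, h1⟩
  have := Nat.sInf_le this
  omega

/-- the group of differences of lengths -/
def auxH (G0 : Set G) : AddSubgroup ℤ where
  carrier := {z | ∃ B, IsZeroSumSeq G0 B ∧ ∃ x ∈ lengthSet G0 B, ∃ y ∈ lengthSet G0 B,
    z = (x : ℤ) - y}
  add_mem' := by
    rintro _ _ ⟨B, hB, x, hx, y, hy, rfl⟩ ⟨C, hC, x', hx', y', hy', rfl⟩
    exact ⟨B + C, aux_zs_add hB hC, _, aux_add hx hx', _, aux_add hy hy', by push_cast; ring⟩
  zero_mem' := ⟨0, ⟨by simp, by simp⟩, 0, ⟨fun _ => 0, fun i => i.elim0, by simp⟩, 0,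
    ⟨fun _ => 0, fun i => i.elim0, by simp⟩, by simp⟩
  neg_mem' := by
    rintro _ ⟨B, hB, x, hx, y, hy, rfl⟩
    exact ⟨B, hB, y, hy, x, hx, by ring⟩

lemma aux_dvd {G0 : Set G} (hne : (deltaG0 G0).Nonempty) {B : Multiset G}
    (hB : IsZeroSumSeq G0 B) {x y : ℕ}
    (hx : x ∈ lengthSet G0 B) (hy : y ∈ lengthSet G0 B) :
    ((sInf (deltaG0 G0) : ℕ) : ℤ) ∣ (x : ℤ) - y := by
  have hd := Nat.sInf_mem hne
  have hmin : ∀ z ∈ auxH G0, 0 < z → ((sInf (deltaG0 G0) : ℕ) : ℤ) ≤ z := by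
    rintro _ ⟨C, hC, x, hx, y, hy, rfl⟩ h
    have := aux_min hC hx hy (by omega)
    omega
  generalize sInf (deltaG0 G0) = d at *
  have hdH : (d : ℤ) ∈ auxH G0 ∧ 0 < d := by
    simp only [deltaG0, Set.mem_iUnion] at hd
    obtain ⟨_, ⟨C, hC, rfl⟩, h0, a, ha, had, -⟩ := hd
    exact ⟨⟨C, hC, _, had, _, ha, by push_cast; ring⟩, h0⟩
  have hz : (x : ℤ) - y ∈ auxH G0 := ⟨B, hB, x, hx, y, hy, rfl⟩
  generalize (x : ℤ) - y = z at *
  have hr : z % d ∈ auxH G0 := by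
    rw [Int.emod_def]
    refine sub_mem hz ?_
    rw [mul_comm, ← smul_eq_mul]
    exact AddSubgroup.zsmul_mem _ hdH.1 _
  apply Int.dvd_of_emod_eq_zero
  have h1 := Int.emod_nonneg z (b := d) (by omega)
  have h2 := Int.emod_lt_of_pos z (b := d) (by omega)
  by_contra h3
  have := hmin _ hr (by omega)
  omega

lemma aux_aap {G0 : Set G} (hne : (deltaG0 G0).Nonempty) {B : Multiset G}
    (hB : IsZeroSumSeq G0 B) (hd : sInf (deltaG0 G0) ∈ deltaOf (lengthSet G0 B)) (K : ℕ) :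
    ∃ M, IsAAP (lengthSet (Set.univ : Set G) (K • B)) (sInf (deltaG0 G0)) K M := by
  have hKB := aux_zs_nsmul hB K
  rw [aux_univ hKB]
  obtain ⟨h0, a, ha, had, -⟩ := hd
  have hdv := fun x (hx : x ∈ lengthSet G0 (K • B)) => aux_dvd hne hKB hx (aux_nsmul ha K)
  generalize sInf (deltaG0 G0) = d at *
  have hprog : ∀ i ≤ K, K * a + d * i ∈ lengthSet G0 (K • B) := by
    intro i hi
    have := aux_add (aux_nsmul ha (K - i)) (aux_nsmul had i)
    rw [← add_nsmul, Nat.sub_add_cancel hi] at this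
    convert this using 1
    obtain ⟨j, rfl⟩ := Nat.exists_eq_add_of_le hi
    rw [Nat.add_sub_cancel_left]
    ring
  have hle := fun x (hx : x ∈ lengthSet G0 (K • B)) => aux_le_card hx
  generalize lengthSet G0 (K • B) = L at *
  generalize Multiset.card (K • B) = N at *
  refine ⟨K * a + N, ((K * a : ℕ) : ℤ),
    {z | z < 0 ∧ ∃ x ∈ L, (x : ℤ) = ((K * a : ℕ) : ℤ) + z},
    {z | (K : ℤ) * d < z ∧ ∃ x ∈ L, (x : ℤ) = ((K * a : ℕ) : ℤ) + z}, ?_, ?_, ?_, hdv⟩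
  · rintro z ⟨hz, x, hx, hxz⟩
    have := hle x hx
    constructor <;> omega
  · rintro z ⟨hz, x, hx, hxz⟩
    have := hle x hx
    have h5 : (0 : ℤ) ≤ (K : ℤ) * d := by positivity
    generalize (K : ℤ) * d = w at *
    have h6 : 0 ≤ K * a := Nat.zero_le _
    generalize K * a = v at *
    constructor <;> push_cast at * <;> omega
  · ext w
    constructor
    · rintro ⟨x, hx, rfl⟩
      refine ⟨(x : ℤ) - ((K * a : ℕ) : ℤ), ?_, by simp⟩
      by_cases h1 : (x : ℤ) - ((K * a : ℕ) : ℤ) < 0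
      · exact Or.inl (Or.inl ⟨h1, x, hx, by ring⟩)
      by_cases h2 : (K : ℤ) * d < (x : ℤ) - ((K * a : ℕ) : ℤ)
      · exact Or.inr ⟨h2, x, hx, by ring⟩
      refine Or.inl (Or.inr ?_)
      obtain ⟨i, hi⟩ := hdv x hx
      rw [hi] at h1 h2 ⊢
      have hd' : (0 : ℤ) < d := by exact_mod_cast h0
      refine ⟨i, ⟨?_, ?_⟩, rfl⟩
      · by_contra h; exact h1 (mul_neg_of_pos_of_neg hd' (by omega))
      · push Not at h2
        rw [mul_comm] at h2
        exact le_of_mul_le_mul_right h2 hd'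
    · rintro ⟨z, (⟨-, x, hx, hxz⟩ | ⟨i, ⟨hi0, hi1⟩, rfl⟩) | ⟨-, x, hx, hxz⟩, rfl⟩
      · exact ⟨x, hx, hxz⟩
      · lift i to ℕ using hi0
        exact ⟨_, hprog i (by exact_mod_cast hi1), by push_cast; ring⟩
      · exact ⟨x, hx, hxz⟩

lemma aux_rho_mono {G0 : Set G} {B : Multiset G} {m K : ℕ} (hm : m ∈ lengthSet G0 B)
    (hm0 : 0 < m) (hK : 0 < K) :
    rhoL (lengthSet G0 B) ≤ rhoL (lengthSet G0 (K • B)) := by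
  have key : ∀ (C : Multiset G) (m : ℕ), m ∈ lengthSet G0 C → 0 < m →
      sInf (lengthSet G0 C) ≠ 0 := by
    intro C m hm hm0 h
    have h1 := Nat.sInf_mem ⟨m, hm⟩
    rw [h] at h1
    obtain ⟨U, -, hU⟩ := h1
    have := aux_le_card hm
    rw [hU] at this
    simp at this
    omega
  have hmK := aux_nsmul hm K
  have h1 := key B m hm hm0
  have h2 := key _ _ hmK (by positivity)
  unfold rhoL
  rw [if_neg h1, if_neg h2]
  have h3 : K * sSup (lengthSet G0 B) ≤ sSup (lengthSet G0 (K • B)) :=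
    le_csSup (aux_bdd _ _) (aux_nsmul (Nat.sSup_mem ⟨m, hm⟩ (aux_bdd _ _)) K)
  have h4 : sInf (lengthSet G0 (K • B)) ≤ K * sInf (lengthSet G0 B) :=
    Nat.sInf_le (aux_nsmul (Nat.sInf_mem ⟨m, hm⟩) K)
  generalize sInf (lengthSet G0 B) = p at *
  generalize sInf (lengthSet G0 (K • B)) = p' at *
  generalize sSup (lengthSet G0 B) = q at *
  generalize sSup (lengthSet G0 (K • B)) = q' at *
  rw [div_le_div_iff₀ (by exact_mod_cast Nat.pos_of_ne_zero h1)
    (by exact_mod_cast Nat.pos_of_ne_zero h2)]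
  have : q * p' ≤ q' * p := calc
    q * p' ≤ q * (K * p) := Nat.mul_le_mul_left _ h4
    _ = (K * q) * p := by ring
    _ ≤ q' * p := Nat.mul_le_mul_right _ h3
  exact_mod_cast this

end Helpers


/-- Let `G` be a finite abelian group with `D(G) ≥ 4` and
`G₀ ⊆ G` with `Δ(G₀) ≠ ∅`. Then `min Δ(G₀) ∈ Δ₁(G)`, and for every
`B ∈ 𝓑(G₀)` with `min Δ(G₀) ∈ Δ(L(B))` one has
`ρ(G, min Δ(G₀)) ≥ ρ(L(B))`. -/
theorem stmt16 {G : Type*} [AddCommGroup G] [Fintype G]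
    (hD : 4 ≤ davenport G)
    (G0 : Set G) (hne : deltaG0 G0 ≠ ∅) :
    sInf (deltaG0 G0) ∈ delta1 G ∧
    ∀ B : Multiset G, IsZeroSumSeq G0 B →
      sInf (deltaG0 G0) ∈ deltaOf (lengthSet G0 B) →
      rhoL (lengthSet G0 B) ≤ rhoGd G (sInf (deltaG0 G0)) := by
  have hne' : (deltaG0 G0).Nonempty := Set.nonempty_iff_ne_empty.2 hne
  refine ⟨?_, ?_⟩
  · have hd := Nat.sInf_mem hne'
    have hd' := hd
    simp only [deltaG0, Set.mem_iUnion] at hd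
    obtain ⟨_, ⟨C, hC, rfl⟩, hd⟩ := hd
    refine ⟨hd.1, fun k => ?_⟩
    obtain ⟨M, hM⟩ := aux_aap hne' hC hd k
    exact ⟨_, ⟨k • C, ⟨fun g _ => Set.mem_univ g, (aux_zs_nsmul hC k).2⟩, rfl⟩, k, le_rfl, M, hM⟩
  · intro B hB hd
    refine le_ciInf fun k => ?_
    obtain ⟨M, hM⟩ := aux_aap hne' hB hd (k + 1)
    obtain ⟨h0, a, ha, had, -⟩ := hd
    refine (aux_rho_mono had (by omega) (Nat.succ_pos k)).trans ?_
    rw [← aux_univ (aux_zs_nsmul hB _)]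
    refine le_csSup ⟨davenport G, ?_⟩ ⟨_, ⟨⟨(k + 1) • B,
      ⟨fun g _ => Set.mem_univ g, (aux_zs_nsmul hB _).2⟩, rfl⟩, k + 1, Nat.le_succ k, M, hM⟩, rfl⟩
    rintro _ ⟨_, ⟨⟨C, -, rfl⟩, -⟩, rfl⟩
    exact aux_rho_le hD C
end
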